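/- For all C > 1 the following holds. Let n, s be positive integers and let P be an n-vertex s-graph. Suppose μ is a (C·n^{−s+1})-spread probability distribution on the set of perfect matchings of P. Let I be a 2-graph with v vertices and c ≤ n/2 components such that V(I) ⊆ V(P), and let M be a random perfect matching of P drawn according to μ. Then P[I ⊆ ∂₂M] ≤ (2C)^v · n^{c−v}. -/

import Mathlib

/-- `P` is an `s`-uniform hypergraph on vertex set `Fin n`. -/
def IsHG (s n : ℕ) (P : Finset (Finset (Fin n))) : Prop := ∀ e ∈ P, e.card = s

/-- `M` is a perfect matching of the vertex set `S` using edges of `P`: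
pairwise disjoint edges of `P` inside `S` covering all of `S`. -/
def IsPMOn {n : ℕ} (S : Finset (Fin n)) (P : Finset (Finset (Fin n)))
    (M : Finset (Finset (Fin n))) : Prop :=
  M ⊆ P ∧ (∀ e ∈ M, e ⊆ S) ∧ (∀ e ∈ M, ∀ f ∈ M, e ≠ f → Disjoint e f) ∧
    ∀ v ∈ S, ∃ e ∈ M, v ∈ e

open Classical in
/-- The probability of the event `Q` for `M` drawn according to `μ`. -/
noncomputable def pmProb {n : ℕ} (μ : Finset (Finset (Fin n)) → ℝ)
    (Q : Finset (Finset (Fin n)) → Prop) : ℝ :=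
  ∑ M : Finset (Finset (Fin n)), if Q M then μ M else 0

/-- `μ` is a probability distribution on the perfect matchings of `S` in `P`. -/
def IsPMDist {n : ℕ} (S : Finset (Fin n)) (P : Finset (Finset (Fin n)))
    (μ : Finset (Finset (Fin n)) → ℝ) : Prop :=
  (∀ M, 0 ≤ μ M) ∧ (∀ M, μ M ≠ 0 → IsPMOn S P M) ∧
    (∑ M : Finset (Finset (Fin n)), μ M) = 1

/-- `μ` is `q`-spread: `P[N ⊆ M] ≤ q^{|N|}` for every set `N` of edges of `P`. -/
def IsSpreadPM {n : ℕ} (P : Finset (Finset (Fin n))) (q : ℝ)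
    (μ : Finset (Finset (Fin n)) → ℝ) : Prop :=
  ∀ N : Finset (Finset (Fin n)), N ⊆ P → pmProb μ (fun M => N ⊆ M) ≤ q ^ N.card

open Classical in
/-- The number of components of the `2`-graph `I` (connected components
containing at least one edge). -/
noncomputable def numCompsF {n : ℕ} (I : Finset (Finset (Fin n))) : ℕ :=
  (I.image (fun e => I.filter (fun f =>
    Relation.ReflTransGen (fun a b => a ∈ I ∧ b ∈ I ∧ ∃ v, v ∈ a ∧ v ∈ b) e f))).card

/-- The vertex set spanned by the edges of `I`. -/
def vertsF {n : ℕ} (I : Finset (Finset (Fin n))) : Finset (Fin n) := I.biUnion id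

theorem pmProb_le_sum {n : ℕ} {ι : Type*} {μ : Finset (Finset (Fin n)) → ℝ}
    (hμ : ∀ M, 0 ≤ μ M) (S : Finset ι) (Q : Finset (Finset (Fin n)) → Prop)
    (R : ι → Finset (Finset (Fin n)) → Prop)
    (h : ∀ M, μ M ≠ 0 → Q M → ∃ i ∈ S, R i M) :
    pmProb μ Q ≤ ∑ i ∈ S, pmProb μ (R i) := by
  classical
  unfold pmProb
  rw [Finset.sum_comm]
  refine Finset.sum_le_sum fun M _ => ?_
  have hnonneg : ∀ i ∈ S, 0 ≤ if R i M then μ M else 0 := fun i _ => by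
    split_ifs
    exacts [hμ M, le_rfl]
  split_ifs with hQ
  · by_cases hM : μ M = 0
    · rw [hM] at hnonneg ⊢
      exact Finset.sum_nonneg hnonneg
    · obtain ⟨i, hi, hR⟩ := h M hM hQ
      refine le_trans ?_ (Finset.single_le_sum hnonneg hi)
      rw [if_pos hR]
  · exact Finset.sum_nonneg hnonneg

theorem pmProb_mono {n : ℕ} {μ : Finset (Finset (Fin n)) → ℝ} (hμ : ∀ M, 0 ≤ μ M)
    {Q R : Finset (Finset (Fin n)) → Prop} (h : ∀ M, μ M ≠ 0 → Q M → R M) :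
    pmProb μ Q ≤ pmProb μ R := by
  simpa using pmProb_le_sum hμ {()} Q (fun _ => R) (by simpa using h)

/-- At most `n ^ (s - |A|)` edges of an `s`-graph on `n` vertices contain a given set `A`. -/
theorem IsHG.card_filter_subset_le {s n : ℕ} {P : Finset (Finset (Fin n))} (hP : IsHG s n P)
    (A : Finset (Fin n)) :
    ((P.filter (A ⊆ ·)).card : ℝ) ≤ (n : ℝ) ^ ((s : ℤ) - A.card) := by
  by_cases h : A.card ≤ s
  · have hcard : (P.filter (A ⊆ ·)).card ≤ n ^ (s - A.card) := by
      calc (P.filter (A ⊆ ·)).card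
          ≤ (Finset.powersetCard (s - A.card) (Finset.univ : Finset (Fin n))).card := by
            refine Finset.card_le_card_of_injOn (· \ A) (fun e he => ?_) fun e he f hf hef => ?_
            · obtain ⟨heP, heA⟩ := Finset.mem_filter.mp he
              simp [Finset.mem_powersetCard, Finset.card_sdiff_of_subset heA, hP e heP]
            · rw [← Finset.sdiff_union_of_subset (Finset.mem_filter.mp he).2,
                ← Finset.sdiff_union_of_subset (Finset.mem_filter.mp hf).2]
              exact congrArg (· ∪ A) hef
        _ ≤ n ^ (s - A.card) := by
            rw [Finset.card_powersetCard, Finset.card_univ, Fintype.card_fin]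
            exact Nat.choose_le_pow _ _
    rw [← Nat.cast_sub h, zpow_natCast]
    exact_mod_cast hcard
  · have : P.filter (A ⊆ ·) = ∅ := Finset.filter_eq_empty_iff.mpr fun e he hA =>
      h (hP e he ▸ Finset.card_le_card hA)
    rw [this]
    simpa using zpow_nonneg (Nat.cast_nonneg n) _

theorem one_add_two_mul_pow_le {x : ℝ} (hx : 0 < x) {k : ℕ} (hk : (k : ℝ) ≤ x) :
    (1 + 2 * x) ^ k ≤ 2 * (2 * x) ^ k := by
  have hy : 0 < 1 + 2 * x := by linarith
  have ha : (1 + 2 * x)⁻¹ ≤ 1 := inv_le_one_of_one_le₀ (by linarith)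
  have hbern := one_add_mul_le_pow (a := -(1 + 2 * x)⁻¹) (by linarith) k
  have hhalf : (k : ℝ) * (1 + 2 * x)⁻¹ ≤ 1 / 2 := by
    rw [← div_eq_mul_inv, div_le_iff₀ hy]
    linarith
  have hbase : 1 + -(1 + 2 * x)⁻¹ = 2 * x / (1 + 2 * x) := by
    field_simp
    ring
  rw [hbase, div_pow] at hbern
  have : 1 / 2 ≤ (2 * x) ^ k / (1 + 2 * x) ^ k := by linarith
  rw [le_div_iff₀ (pow_pos hy k)] at this
  linarith

/-- `M` contains `N`, and each set in `T` lies in an edge of `M` outside `N`. -/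
def ContainsCovers {n : ℕ} (N T M : Finset (Finset (Fin n))) : Prop :=
  N ⊆ M ∧ ∀ t ∈ T, ∃ f ∈ M, f ∉ N ∧ t ⊆ f

/-- If `μ` is spread, then a random perfect matching contains `N` and covers each of the disjoint
sets in `T` by edges outside `N` only with the stated probability. -/
theorem IsSpreadPM.pmProb_cover_le {C : ℝ} (hC : 1 < C) {n s : ℕ} (hn : 0 < n)
    {P : Finset (Finset (Fin n))} (hP : IsHG s n P) {μ : Finset (Finset (Fin n)) → ℝ}
    (hdist : IsPMDist Finset.univ P μ)
    (hspread : IsSpreadPM P (C * (n : ℝ) ^ ((1 : ℤ) - (s : ℤ))) μ)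
    (T : Finset (Finset (Fin n))) (hTn : T.card ≤ n)
    (hT : (T : Set (Finset (Fin n))).PairwiseDisjoint id)
    (N : Finset (Finset (Fin n))) (hN : N ⊆ P) :
    pmProb μ (ContainsCovers N T) ≤
      (C * (n : ℝ) ^ ((1 : ℤ) - (s : ℤ))) ^ N.card * (2 * (C * n)) ^ T.card *
        (n : ℝ) ^ (-((T.biUnion id).card : ℤ)) := by
  classical
  have hn0 : (0 : ℝ) < n := by exact_mod_cast hn
  have hx : 0 < C * n := mul_pos (by linarith) hn0
  have hq0 : 0 ≤ C * (n : ℝ) ^ ((1 : ℤ) - (s : ℤ)) := by positivity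
  generalize hq : C * (n : ℝ) ^ ((1 : ℤ) - (s : ℤ)) = q at hq0 hspread ⊢
  induction T using Finset.strongInduction generalizing N with
  | H T ih =>
  rcases T.eq_empty_or_nonempty with rfl | ⟨t₀, ht₀⟩
  · have hcov : ContainsCovers N ∅ = (N ⊆ ·) := by simp [ContainsCovers, funext_iff]
    simpa [hcov] using hspread N hN
  set T' := T.erase t₀ with hT'
  have hT'T : T' ⊂ T := Finset.erase_ssubset ht₀
  have hcardT : T.card = T'.card + 1 := (Finset.card_erase_add_one ht₀).symm
  let A : Finset (Finset (Fin n)) → Finset (Fin n) := fun B => (insert t₀ B).biUnion id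
  let edges : Finset (Finset (Fin n)) → Finset (Finset (Fin n)) := fun B =>
    P.filter fun e => A B ⊆ e ∧ e ∉ N
  have hunion : pmProb μ (ContainsCovers N T) ≤
      ∑ B ∈ T'.powerset, ∑ e ∈ edges B, pmProb μ (ContainsCovers (insert e N) (T' \ B)) := by
    rw [Finset.sum_sigma']
    apply pmProb_le_sum hdist.1
    intro M hM ⟨hNM, hcov⟩
    obtain ⟨e, heM, heN, hte⟩ := hcov t₀ ht₀
    refine ⟨⟨T'.filter (· ⊆ e), e⟩, ?_, Finset.insert_subset heM hNM, fun t ht => ?_⟩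
    · simp only [Finset.mem_sigma, Finset.mem_powerset, Finset.filter_subset, true_and, edges,
        Finset.mem_filter, A, Finset.biUnion_subset, Finset.mem_insert]
      refine ⟨(hdist.2.1 M hM).1 heM, ?_, heN⟩
      rintro t (rfl | ht)
      exacts [hte, ht.2]
    · obtain ⟨htT', hte'⟩ := Finset.mem_sdiff.mp ht
      obtain ⟨f, hfM, hfN, htf⟩ := hcov t (hT'T.1 htT')
      refine ⟨f, hfM, ?_, htf⟩
      rw [Finset.mem_insert, not_or]
      refine ⟨?_, hfN⟩
      rintro rfl
      exact hte' (Finset.mem_filter.mpr ⟨htT', htf⟩)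
  have hblock : ∀ B ∈ T'.powerset,
      (∑ e ∈ edges B, pmProb μ (ContainsCovers (insert e N) (T' \ B))) ≤
      q ^ N.card * (C * n) * (n : ℝ) ^ (-((T.biUnion id).card : ℤ)) *
        (1 ^ B.card * (2 * (C * n)) ^ (T'.card - B.card)) := by
    intro B hB
    have hBT' := Finset.mem_powerset.mp hB
    have hsub : T' \ B ⊂ T := Finset.sdiff_subset.trans_ssubset hT'T
    have hsum : (T.biUnion id).card = (A B).card + ((T' \ B).biUnion id).card := by
      have hTeq : T = insert t₀ B ∪ T' \ B := by
        rw [Finset.insert_union, Finset.union_sdiff_of_subset hBT', hT', Finset.insert_erase ht₀]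
      have hAB : insert t₀ B ⊆ T := Finset.insert_subset ht₀ (hBT'.trans hT'T.1)
      have hdisj : Disjoint (insert t₀ B) (T' \ B) := by
        rw [Finset.disjoint_insert_left]
        exact ⟨by simp [hT'], Finset.disjoint_sdiff⟩
      simp only [A]
      rw [Finset.card_biUnion hT, Finset.card_biUnion (hT.subset (by exact_mod_cast hAB)),
        Finset.card_biUnion (hT.subset (by exact_mod_cast hsub.1)), ← Finset.sum_union hdisj,
        ← hTeq]
    have hedges : ((edges B).card : ℝ) ≤ (n : ℝ) ^ ((s : ℤ) - (A B).card) :=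
      le_trans (Nat.cast_le.mpr (Finset.card_le_card fun e he =>
        Finset.mem_filter.mpr ⟨(Finset.mem_filter.mp he).1, (Finset.mem_filter.mp he).2.1⟩))
        (hP.card_filter_subset_le (A B))
    have hterm : ∀ e ∈ edges B, pmProb μ (ContainsCovers (insert e N) (T' \ B)) ≤
        q ^ (N.card + 1) * (2 * (C * n)) ^ (T'.card - B.card) *
          (n : ℝ) ^ (-(((T' \ B).biUnion id).card : ℤ)) := by
      intro e he
      obtain ⟨heP, -, heN⟩ := Finset.mem_filter.mp he
      have := ih (T' \ B) hsub ((Finset.card_le_card hsub.1).trans hTn)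
        (hT.subset (by exact_mod_cast hsub.1)) (insert e N) (Finset.insert_subset heP hN)
      rwa [Finset.card_insert_of_notMem heN, Finset.card_sdiff_of_subset hBT'] at this
    refine (Finset.sum_le_card_nsmul _ _ _ hterm).trans ?_
    rw [nsmul_eq_mul]
    refine (mul_le_mul_of_nonneg_right hedges (by positivity)).trans (le_of_eq ?_)
    have hexp : (n : ℝ) ^ ((s : ℤ) - (A B).card) * (n : ℝ) ^ ((1 : ℤ) - s) *
        (n : ℝ) ^ (-(((T' \ B).biUnion id).card : ℤ)) =
        n * (n : ℝ) ^ (-((T.biUnion id).card : ℤ)) := by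
      rw [← zpow_add₀ hn0.ne', ← zpow_add₀ hn0.ne', ← zpow_one_add₀ hn0.ne', hsum]
      congr 1
      push_cast
      ring
    rw [pow_succ, one_pow, one_mul]
    nth_rewrite 2 [← hq]
    linear_combination q ^ N.card * C * (2 * (C * n)) ^ (T'.card - B.card) * hexp
  refine hunion.trans ((Finset.sum_le_sum hblock).trans ?_)
  rw [← Finset.mul_sum, Finset.sum_pow_mul_eq_add_pow, hcardT, pow_succ]
  have hk : (T'.card : ℝ) ≤ C * n := by
    have : (T'.card : ℝ) ≤ n := by exact_mod_cast (by omega : T'.card ≤ n)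
    nlinarith
  calc _ ≤ q ^ N.card * (C * n) * (n : ℝ) ^ (-((T.biUnion id).card : ℤ)) *
        (2 * (2 * (C * n)) ^ T'.card) :=
        mul_le_mul_of_nonneg_left (one_add_two_mul_pow_le hx hk) (by positivity)
    _ = _ := by ring

/-- **Spread matching to correct distribution.**  If `μ` is a
`(C n^{-s+1})`-spread distribution on the perfect matchings of an `n`-vertex
`s`-graph `P` and `I` is a `2`-graph on `V(P)` with `v` vertices and
`c ≤ n/2` components, then `P[I ⊆ ∂₂M] ≤ (2C)^v n^{c-v}`. -/
theorem spread_matching_correct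
    (C : ℝ) (hC : 1 < C) (n s : ℕ) (hn : 0 < n) (hs : 0 < s)
    (P : Finset (Finset (Fin n))) (hP : IsHG s n P)
    (μ : Finset (Finset (Fin n)) → ℝ)
    (hdist : IsPMDist Finset.univ P μ)
    (hspread : IsSpreadPM P (C * (n : ℝ) ^ ((1 : ℤ) - (s : ℤ))) μ)
    (I : Finset (Finset (Fin n))) (hI : ∀ e ∈ I, e.card = 2)
    (hc : (numCompsF I : ℝ) ≤ (n : ℝ) / 2) :
    pmProb μ (fun M => ∀ e ∈ I, ∃ f ∈ M, e ⊆ f)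
      ≤ (2 * C) ^ (vertsF I).card *
        (n : ℝ) ^ ((numCompsF I : ℤ) - ((vertsF I).card : ℤ)) := by
  classical
  have hn0 : (0 : ℝ) < n := by exact_mod_cast hn
  have hn1 : (1 : ℝ) ≤ n := by exact_mod_cast hn
  let r : Finset (Fin n) → Finset (Fin n) → Prop := fun a b =>
    a ∈ I ∧ b ∈ I ∧ ∃ v, v ∈ a ∧ v ∈ b
  have hsymm : Std.Symm r := ⟨fun a b ⟨ha, hb, v, hva, hvb⟩ => ⟨hb, ha, v, hvb, hva⟩⟩
  let cls : Finset (Fin n) → Finset (Finset (Fin n)) := fun e =>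
    I.filter fun f => Relation.ReflTransGen r e f
  let T : Finset (Finset (Fin n)) := (I.image cls).image fun K => K.biUnion id
  have hTc : T.card ≤ numCompsF I := by
    refine Finset.card_image_le.trans (le_of_eq ?_)
    unfold numCompsF
    congr!
  have hTn : T.card ≤ n := by
    have : (T.card : ℝ) ≤ numCompsF I := by exact_mod_cast hTc
    exact_mod_cast (by linarith : (T.card : ℝ) ≤ n)
  have hmemT : ∀ t ∈ T, ∃ e ∈ I, t = (cls e).biUnion id := by
    intro t ht
    simp only [T, Finset.mem_image] at ht
    obtain ⟨K, ⟨e, he, rfl⟩, rfl⟩ := ht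
    exact ⟨e, he, rfl⟩
  have hself : ∀ e ∈ I, e ∈ cls e := fun e he => Finset.mem_filter.mpr ⟨he, .refl⟩
  have hdisj : (T : Set (Finset (Fin n))).PairwiseDisjoint id := by
    intro t ht u hu htu
    obtain ⟨a, ha, rfl⟩ := hmemT t ht
    obtain ⟨b, hb, rfl⟩ := hmemT u hu
    refine Finset.disjoint_left.mpr fun v hva hvb => htu ?_
    obtain ⟨f, hf, hvf⟩ := Finset.mem_biUnion.mp hva
    obtain ⟨g, hg, hvg⟩ := Finset.mem_biUnion.mp hvb
    obtain ⟨hfI, haf⟩ := Finset.mem_filter.mp hf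
    obtain ⟨hgI, hbg⟩ := Finset.mem_filter.mp hg
    have hab : Relation.ReflTransGen r a b :=
      (haf.tail ⟨hfI, hgI, v, hvf, hvg⟩).trans (Relation.ReflTransGen.stdSymm.symm _ _ hbg)
    have hba : Relation.ReflTransGen r b a := Relation.ReflTransGen.stdSymm.symm _ _ hab
    congr 1
    exact Finset.filter_congr fun x _ => ⟨hba.trans, hab.trans⟩
  have hverts : T.biUnion id = vertsF I := by
    ext v
    simp only [Finset.mem_biUnion, vertsF, id]
    constructor
    · rintro ⟨t, ht, hvt⟩
      obtain ⟨e, he, rfl⟩ := hmemT t ht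
      obtain ⟨f, hf, hvf⟩ := Finset.mem_biUnion.mp hvt
      exact ⟨f, (Finset.mem_filter.mp hf).1, hvf⟩
    · rintro ⟨e, he, hve⟩
      exact ⟨(cls e).biUnion id, Finset.mem_image_of_mem _ (Finset.mem_image_of_mem _ he),
        Finset.mem_biUnion.mpr ⟨e, hself e he, hve⟩⟩
  have hTv : T.card ≤ (vertsF I).card := by
    rw [← hverts, Finset.card_biUnion hdisj, Finset.card_eq_sum_ones]
    refine Finset.sum_le_sum fun t ht => Finset.card_pos.mpr ?_
    obtain ⟨e, he, rfl⟩ := hmemT t ht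
    obtain ⟨v, hv⟩ := Finset.card_pos.mp (by rw [hI e he]; norm_num : 0 < e.card)
    exact ⟨v, Finset.mem_biUnion.mpr ⟨e, hself e he, hv⟩⟩
  have hcover : pmProb μ (fun M => ∀ e ∈ I, ∃ f ∈ M, e ⊆ f) ≤
      pmProb μ (ContainsCovers ∅ T) := by
    refine pmProb_mono hdist.1 fun M hM hIM => ⟨Finset.empty_subset M, fun t ht => ?_⟩
    obtain ⟨e, he, rfl⟩ := hmemT t ht
    obtain ⟨f, hfM, hef⟩ := hIM e he
    refine ⟨f, hfM, Finset.notMem_empty f, Finset.biUnion_subset.mpr fun g hg => ?_⟩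
    have hreach := (Finset.mem_filter.mp hg).2
    clear hg
    induction hreach with
    | refl => exact hef
    | tail _ hbc ih =>
      obtain ⟨-, hcI, v, hvb, hvc⟩ := hbc
      obtain ⟨f', hf'M, hcf'⟩ := hIM _ hcI
      by_cases hff' : f = f'
      · exact hff' ▸ hcf'
      · exact absurd (hcf' hvc) (Finset.disjoint_left.mp
          ((hdist.2.1 M hM).2.2.1 f hfM f' hf'M hff') (ih hvb))
  refine hcover.trans ((hspread.pmProb_cover_le hC hn hP hdist T hTn hdisj ∅
    (Finset.empty_subset P)).trans ?_)
  rw [Finset.card_empty, pow_zero, one_mul, hverts, ← mul_assoc, mul_pow, mul_assoc,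
    ← zpow_natCast (n : ℝ), ← zpow_add₀ hn0.ne']
  have hTc' : (T.card : ℤ) ≤ numCompsF I := by exact_mod_cast hTc
  exact mul_le_mul (pow_le_pow_right₀ (by linarith) hTv)
    (zpow_le_zpow_right₀ hn1 (by linarith)) (by positivity) (by positivity)
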